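/- For real α, β with α + β + 2n < -1 and α > -1, α, β, α+β ∉ ℤ, the Jacobi polynomial satisfies ∫_1^∞ t^k P_n^{(α,β)}(t) (t-1)^α (t+1)^β dt = 0 for k = 0, 1, …, n-1, and this integral is nonzero (in fact the integrals converge) for k = n; consequently P_n^{(α,β)} has exactly n simple zeros in (1, ∞). -/

import Mathlib

open Finset Polynomial MeasureTheory

/-- Generalized binomial coefficient `C(x, m) = x(x-1)⋯(x-m+1)/m!` for real `x`. -/
noncomputable def gbinomR (x : ℝ) (m : ℕ) : ℝ :=
  (∏ i ∈ Finset.range m, (x - i)) / (Nat.factorial m)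

/-- The Jacobi polynomial `P_n^{(α,β)}` for real parameters, as a real polynomial. -/
noncomputable def jacobiR (n : ℕ) (α β : ℝ) : Polynomial ℝ :=
  (2 : ℝ)⁻¹ ^ n • ∑ j ∈ Finset.range (n + 1),
    Polynomial.C (gbinomR ((n : ℝ) + α) (n - j) * gbinomR ((n : ℝ) + β) j) *
      (Polynomial.X - 1) ^ j * (Polynomial.X + 1) ^ (n - j)


lemma aux_rpow_bigO (c a : ℝ) :
    (fun t : ℝ => (t + c) ^ a) =O[Filter.atTop] (fun t : ℝ => t ^ a) := by
  have h1 : Filter.Tendsto (fun t : ℝ => ((t + c) / t) ^ a) Filter.atTop (nhds 1) := by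
    have h2 : Filter.Tendsto (fun t : ℝ => 1 + c / t) Filter.atTop (nhds (1 + 0)) :=
      tendsto_const_nhds.add (Filter.Tendsto.const_div_atTop Filter.tendsto_id c)
    rw [add_zero] at h2
    have h3 := h2.rpow_const (p := a) (Or.inl one_ne_zero)
    rw [Real.one_rpow] at h3
    refine h3.congr' ?_
    filter_upwards [Filter.eventually_gt_atTop 0] with t ht
    rw [add_div, div_self ht.ne']
  have h4 := (h1.isBigO_one ℝ).mul (Asymptotics.isBigO_refl (fun t : ℝ => t ^ a) Filter.atTop)
  simp only [one_mul] at h4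
  refine Asymptotics.IsBigO.congr' h4 ?_ Filter.EventuallyEq.rfl
  filter_upwards [Filter.eventually_gt_atTop 0, Filter.eventually_gt_atTop (-c)] with t ht hc
  rw [Real.div_rpow (by linarith) ht.le, div_mul_cancel₀ _ (Real.rpow_pos_of_pos ht a).ne']

lemma aux_bigO (p : ℝ[X]) (d : ℕ) (hp : p.natDegree ≤ d) (a b : ℝ) :
    (fun t : ℝ => p.eval t * (t - 1) ^ a * (t + 1) ^ b) =O[Filter.atTop]
      (fun t : ℝ => t ^ ((d : ℝ) + a + b)) := by
  have h1 : (fun t : ℝ => p.eval t) =O[Filter.atTop] (fun t : ℝ => t ^ d) := by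
    have := Polynomial.isBigO_of_degree_le p (X ^ d)
      (by rw [degree_X_pow]; exact natDegree_le_iff_degree_le.mp hp)
    simpa using this
  have h2 := (h1.mul (aux_rpow_bigO (-1) a)).mul (aux_rpow_bigO 1 b)
  simp only [← sub_eq_add_neg] at h2
  refine Asymptotics.IsBigO.congr' h2 Filter.EventuallyEq.rfl ?_
  filter_upwards [Filter.eventually_gt_atTop 0] with t ht
  rw [Real.rpow_add ht, Real.rpow_add ht, Real.rpow_natCast]

lemma aux_int (p : ℝ[X]) (d : ℕ) (hp : p.natDegree ≤ d) (a b : ℝ) (ha : -1 < a)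
    (hd : (d : ℝ) + a + b < -1) :
    IntegrableOn (fun t : ℝ => p.eval t * (t - 1) ^ a * (t + 1) ^ b) (Set.Ioi 1) := by
  have h1 : IntegrableOn (fun t : ℝ => p.eval t * (t - 1) ^ a * (t + 1) ^ b) (Set.Ioc 1 2) := by
    have h0 : IntervalIntegrable (fun t : ℝ => (t - 1) ^ a) volume 1 2 := by
      have := (intervalIntegral.intervalIntegrable_rpow' (a := 0) (b := 1) ha).comp_sub_right 1
      norm_num at this
      exact this
    have hc : ContinuousOn (fun t : ℝ => p.eval t * (t + 1) ^ b) (Set.uIcc 1 2) := by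
      refine p.continuous.continuousOn.mul ?_
      refine ContinuousOn.rpow_const (by fun_prop) ?_
      intro x hx
      rw [Set.uIcc_of_le (by norm_num)] at hx
      left
      linarith [hx.1]
    have := h0.continuousOn_mul hc
    rw [intervalIntegrable_iff_integrableOn_Ioc_of_le (by norm_num)] at this
    refine this.congr_fun ?_ measurableSet_Ioc
    intro t _
    simp only
    ring
  have h2 : IntegrableOn (fun t : ℝ => p.eval t * (t - 1) ^ a * (t + 1) ^ b) (Set.Ici 2) := by
    refine LocallyIntegrableOn.integrableOn_of_isBigO_atTop ?_ (aux_bigO p d hp a b)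
      ⟨Set.Ioi 1, Filter.Ioi_mem_atTop 1, integrableOn_Ioi_rpow_of_lt hd one_pos⟩
    refine ContinuousOn.locallyIntegrableOn ?_ measurableSet_Ici
    refine (p.continuous.continuousOn.mul ?_).mul ?_
    · refine ContinuousOn.rpow_const (by fun_prop) fun x hx => Or.inl ?_
      have := Set.mem_Ici.mp hx
      linarith
    · refine ContinuousOn.rpow_const (by fun_prop) fun x hx => Or.inl ?_
      have := Set.mem_Ici.mp hx
      linarith
  refine (h1.union h2).mono_set ?_
  intro t ht
  rcases le_total t 2 with h | h
  · exact Or.inl ⟨ht, h⟩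
  · exact Or.inr h

/-- weighted integral of a polynomial -/
noncomputable def auxJ (p : ℝ[X]) (a b : ℝ) : ℝ :=
  ∫ t in Set.Ioi (1:ℝ), p.eval t * (t - 1) ^ a * (t + 1) ^ b

lemma auxJ_add (p q : ℝ[X]) (d : ℕ) (hp : p.natDegree ≤ d) (hq : q.natDegree ≤ d)
    (a b : ℝ) (ha : -1 < a) (hd : (d : ℝ) + a + b < -1) :
    auxJ (p + q) a b = auxJ p a b + auxJ q a b := by
  unfold auxJ
  rw [← integral_add (aux_int p d hp a b ha hd) (aux_int q d hq a b ha hd)]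
  congr 1
  ext t
  rw [eval_add]
  ring

lemma auxJ_C_mul (p : ℝ[X]) (c a b : ℝ) : auxJ (C c * p) a b = c * auxJ p a b := by
  unfold auxJ
  rw [← integral_const_mul]
  congr 1
  ext t
  rw [eval_mul, eval_C]
  ring

lemma auxJ_shift (p : ℝ[X]) (a b : ℝ) :
    auxJ ((X - 1) * (X + 1) * p) a b = auxJ p (a + 1) (b + 1) := by
  unfold auxJ
  refine setIntegral_congr_fun measurableSet_Ioi ?_
  intro t ht
  have h : (1 : ℝ) < t := ht
  simp only [eval_mul, eval_sub, eval_add, eval_X, eval_one]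
  rw [Real.rpow_add_one (by linarith), Real.rpow_add_one (by linarith)]
  ring

lemma auxJ_parts (p : ℝ[X]) (d : ℕ) (hp : p.natDegree ≤ d) (a b : ℝ) (ha : -1 < a)
    (hd : (d : ℝ) + 1 + a + b < -1) :
    auxJ (C (a + 1) * (X + 1) * p + C (b + 1) * (X - 1) * p
      + (X - 1) * (X + 1) * derivative p) a b = 0 := by
  have hdeg : (C (a + 1) * (X + 1) * p + C (b + 1) * (X - 1) * p
      + (X - 1) * (X + 1) * derivative p).natDegree ≤ d + 1 := by
    have hA : (X - 1 : ℝ[X]).natDegree ≤ 1 := by compute_degree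
    have hB : (X + 1 : ℝ[X]).natDegree ≤ 1 := by compute_degree
    have hA' : (C (b + 1) * (X - 1) : ℝ[X]).natDegree ≤ 1 := by compute_degree
    have hB' : (C (a + 1) * (X + 1) : ℝ[X]).natDegree ≤ 1 := by compute_degree
    have hAB : ((X - 1) * (X + 1) : ℝ[X]).natDegree ≤ 2 := natDegree_mul_le_of_le hA hB
    refine natDegree_add_le_of_degree_le (natDegree_add_le_of_degree_le ?_ ?_) ?_
    · exact (natDegree_mul_le_of_le hB' hp).trans (by omega)
    · exact (natDegree_mul_le_of_le hA' hp).trans (by omega)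
    · rcases Nat.eq_zero_or_pos p.natDegree with h0 | h0
      · rw [derivative_of_natDegree_zero h0]
        simp
      · have := natDegree_derivative_lt (Nat.pos_iff_ne_zero.mp h0)
        exact (natDegree_mul_le_of_le hAB (le_refl _)).trans (by omega)
  have hint := aux_int _ (d + 1) hdeg a b ha (by push_cast; linarith)
  have key := integral_Ioi_of_hasDerivAt_of_tendsto (a := (1:ℝ)) (m := 0)
    (f := fun t : ℝ => p.eval t * (t - 1) ^ (a + 1) * (t + 1) ^ (b + 1)) ?_ ?_ hint ?_
  · unfold auxJ
    rw [key]
    have : (0 : ℝ) ^ (a + 1) = 0 := Real.zero_rpow (by linarith)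
    simp [this]
  · apply ContinuousAt.continuousWithinAt
    refine (p.continuous.continuousAt.mul ?_).mul ?_
    · exact ContinuousAt.rpow_const (by fun_prop) (Or.inr (by linarith))
    · exact ContinuousAt.rpow_const (by fun_prop) (Or.inl (by norm_num))
  · intro t ht
    have h : (1 : ℝ) < t := ht
    have h1 : HasDerivAt (fun t : ℝ => (t - 1) ^ (a + 1)) (1 * (a + 1) * (t - 1) ^ (a + 1 - 1)) t :=
      HasDerivAt.rpow_const ((hasDerivAt_id t).sub_const 1) (Or.inl (by simp; linarith))
    have h2 : HasDerivAt (fun t : ℝ => (t + 1) ^ (b + 1)) (1 * (b + 1) * (t + 1) ^ (b + 1 - 1)) t :=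
      HasDerivAt.rpow_const ((hasDerivAt_id t).add_const 1) (Or.inl (by simp; linarith))
    have h3 := ((p.hasDerivAt t).mul h1).mul h2
    refine h3.congr_deriv ?_
    simp only [eval_mul, eval_sub, eval_add, eval_X, eval_one, eval_C, add_sub_cancel_right,
      Pi.mul_apply]
    rw [Real.rpow_add_one (by linarith), Real.rpow_add_one (by linarith)]
    ring
  · refine (aux_bigO p d hp (a + 1) (b + 1)).trans_tendsto ?_
    have := tendsto_rpow_neg_atTop (y := -((d : ℝ) + (a + 1) + (b + 1))) (by linarith)
    simpa only [neg_neg] using this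

lemma auxJ_pos (p : ℝ[X]) (hp0 : p ≠ 0) (d : ℕ) (hp : p.natDegree ≤ d) (a b : ℝ) (ha : -1 < a)
    (hd : (d : ℝ) + a + b < -1) (hpos : ∀ t : ℝ, 1 < t → 0 ≤ p.eval t) :
    0 < auxJ p a b := by
  unfold auxJ
  have hw : ∀ t : ℝ, 1 < t → 0 < (t - 1) ^ a ∧ 0 < (t + 1) ^ b := fun t ht =>
    ⟨Real.rpow_pos_of_pos (by linarith) _, Real.rpow_pos_of_pos (by linarith) _⟩
  rw [setIntegral_pos_iff_support_of_nonneg_ae _ (aux_int p d hp a b ha hd)]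
  · have hsub : Set.Ioi (1:ℝ) \ (p.roots.toFinset : Set ℝ) ⊆
        Function.support (fun t : ℝ => p.eval t * (t - 1) ^ a * (t + 1) ^ b) ∩ Set.Ioi 1 := by
      rintro t ⟨ht, hr⟩
      refine ⟨?_, ht⟩
      have : p.eval t ≠ 0 := by
        intro h
        apply hr
        simp [hp0, h]
      exact mul_ne_zero (mul_ne_zero this (hw t ht).1.ne') (hw t ht).2.ne'
    refine lt_of_lt_of_le ?_ (measure_mono hsub)
    rw [measure_diff_null (Set.Finite.measure_zero (Finset.finite_toSet _) _)]
    simp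
  · filter_upwards [ae_restrict_mem measurableSet_Ioi] with t ht
    exact mul_nonneg (mul_nonneg (hpos t ht) (hw t ht).1.le) (hw t ht).2.le

lemma gbinomR_succ (x : ℝ) (m : ℕ) : ((m : ℝ) + 1) * gbinomR x (m + 1) = (x - m) * gbinomR x m := by
  unfold gbinomR
  rw [Finset.prod_range_succ, Nat.factorial_succ]
  have : (m.factorial : ℝ) ≠ 0 := by positivity
  have : (m : ℝ) + 1 ≠ 0 := by positivity
  push_cast
  field_simp

lemma jacobiR_natDegree (n : ℕ) (α β : ℝ) : (jacobiR n α β).natDegree ≤ n := by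
  unfold jacobiR
  refine (natDegree_smul_le _ _).trans ?_
  refine natDegree_sum_le_of_forall_le _ _ ?_
  intro j hj
  have hj' : j ≤ n := by simpa [Nat.lt_succ_iff] using hj
  have hA : ((X - 1 : ℝ[X]) ^ j).natDegree ≤ j := by
    simpa using natDegree_pow_le_of_le j (show (X - 1 : ℝ[X]).natDegree ≤ 1 by compute_degree)
  have hB : ((X + 1 : ℝ[X]) ^ (n - j)).natDegree ≤ n - j := by
    simpa using natDegree_pow_le_of_le (n - j) (show (X + 1 : ℝ[X]).natDegree ≤ 1 by compute_degree)
  refine (natDegree_mul_le_of_le (natDegree_mul_le_of_le (natDegree_C _).le hA) hB).trans ?_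
  omega

lemma jacobiR_rec (N : ℕ) (α β : ℝ) :
    C (α + 1) * (X + 1) * jacobiR N (α + 1) (β + 1) + C (β + 1) * (X - 1) * jacobiR N (α + 1) (β + 1)
      + (X - 1) * (X + 1) * derivative (jacobiR N (α + 1) (β + 1))
    = C (2 * ((N : ℝ) + 1)) * jacobiR (N + 1) α β := by
  have hterm : ∀ j ∈ Finset.range (N + 1), ∀ c : ℝ,
      C (α + 1) * (X + 1) * (C c * (X - 1) ^ j * (X + 1) ^ (N - j))
      + C (β + 1) * (X - 1) * (C c * (X - 1) ^ j * (X + 1) ^ (N - j))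
      + (X - 1) * (X + 1) * derivative (C c * (X - 1) ^ j * (X + 1) ^ (N - j))
      = C (c * (α + 1 + j)) * ((X - 1) ^ j * (X + 1) ^ (N + 1 - j))
        + C (c * (β + 1 + N - j)) * ((X - 1) ^ (j + 1) * (X + 1) ^ (N + 1 - (j + 1))) := by
    intro j hj c
    have hj' : j ≤ N := by simpa [Nat.lt_succ_iff] using hj
    obtain ⟨i, rfl⟩ := Nat.exists_eq_add_of_le hj'
    have e1 : j + i - j = i := by omega
    have e2 : j + i + 1 - j = i + 1 := by omega
    have e3 : j + i + 1 - (j + 1) = i := by omega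
    rw [e1, e2, e3]
    have hd : ∀ (k : ℕ) (A : ℝ[X]), derivative A = 1 →
        A * derivative (A ^ k) = C (k : ℝ) * A ^ k := by
      intro k A hA
      rw [derivative_pow, hA]
      rcases k with _ | k
      · simp
      · simp [pow_succ]; ring
    have hdA := hd j (X - 1) (by simp)
    have hdB := hd i (X + 1) (by simp)
    rw [derivative_mul, derivative_C_mul]
    have : (X - 1) * (X + 1) * (C c * derivative ((X - 1) ^ j) * (X + 1) ^ i
        + C c * (X - 1) ^ j * derivative ((X + 1) ^ i))
        = C c * (X + 1) * (X + 1) ^ i * ((X - 1) * derivative ((X - 1) ^ j))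
        + C c * (X - 1) * (X - 1) ^ j * ((X + 1) * derivative ((X + 1) ^ i)) := by ring
    rw [this, hdA, hdB]
    simp only [C_add, C_mul, C_sub, Nat.cast_add]
    ring
  set c : ℕ → ℝ := fun j => gbinomR ((N : ℝ) + (α + 1)) (N - j) * gbinomR ((N : ℝ) + (β + 1)) j with hc
  have hL : C (α + 1) * (X + 1) * jacobiR N (α + 1) (β + 1)
      + C (β + 1) * (X - 1) * jacobiR N (α + 1) (β + 1)
      + (X - 1) * (X + 1) * derivative (jacobiR N (α + 1) (β + 1))
      = (2 : ℝ)⁻¹ ^ N • ∑ j ∈ Finset.range (N + 1),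
        (C (c j * (α + 1 + j)) * ((X - 1) ^ j * (X + 1) ^ (N + 1 - j))
        + C (c j * (β + 1 + N - j)) * ((X - 1) ^ (j + 1) * (X + 1) ^ (N + 1 - (j + 1)))) := by
    rw [← Finset.sum_congr rfl (fun j hj => hterm j hj (c j))]
    unfold jacobiR
    rw [derivative_smul, derivative_sum]
    simp only [Finset.sum_add_distrib, ← Finset.mul_sum, mul_smul_comm, smul_add]
    rfl
  rw [hL]
  have hR : C (2 * ((N : ℝ) + 1)) * jacobiR (N + 1) α β = (2 : ℝ)⁻¹ ^ N •
      ∑ j ∈ Finset.range (N + 1 + 1), C (((N : ℝ) + 1) *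
        (gbinomR ((N : ℝ) + 1 + α) (N + 1 - j) * gbinomR ((N : ℝ) + 1 + β) j)) *
        ((X - 1) ^ j * (X + 1) ^ (N + 1 - j)) := by
    unfold jacobiR
    simp only [smul_eq_C_mul, ← mul_assoc, ← C_mul, Finset.mul_sum, Nat.cast_add, Nat.cast_one]
    refine Finset.sum_congr rfl fun j _ => ?_
    have : (2 * ((N : ℝ) + 1)) * 2⁻¹ ^ (N + 1) = 2⁻¹ ^ N * ((N : ℝ) + 1) := by
      rw [pow_succ]; ring
    congr 3
    rw [this]
  rw [hR]
  congr 1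
  rw [Finset.sum_add_distrib]
  set M : ℕ → ℝ[X] := fun j => (X - 1) ^ j * (X + 1) ^ (N + 1 - j) with hM
  -- first sum extended to N+2 terms, second shifted
  have hx : (N : ℝ) + (α + 1) = N + 1 + α := by ring
  have hy : (N : ℝ) + (β + 1) = N + 1 + β := by ring
  have h1 : ∀ j ∈ Finset.range (N + 1), c j * (α + 1 + j) = ((N : ℝ) + 1 - j) *
      (gbinomR ((N : ℝ) + 1 + α) (N + 1 - j) * gbinomR ((N : ℝ) + 1 + β) j) := by
    intro j hj
    have hj' : j ≤ N := by simpa [Nat.lt_succ_iff] using hj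
    obtain ⟨i, rfl⟩ := Nat.exists_eq_add_of_le hj'
    have e1 : j + i - j = i := by omega
    have e2 : j + i + 1 - j = i + 1 := by omega
    simp only [hc, hx, hy, e1, e2]
    have := gbinomR_succ (((j + i : ℕ) : ℝ) + 1 + α) i
    push_cast at this ⊢
    linear_combination -(gbinomR ((j : ℝ) + i + 1 + β) j) * this
  have h2 : ∀ j ∈ Finset.range (N + 1), c j * (β + 1 + N - j) = ((j + 1 : ℕ) : ℝ) *
      (gbinomR ((N : ℝ) + 1 + α) (N + 1 - (j + 1)) * gbinomR ((N : ℝ) + 1 + β) (j + 1)) := by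
    intro j hj
    have e1 : N + 1 - (j + 1) = N - j := by omega
    simp only [hc, hx, hy, e1]
    have := gbinomR_succ ((N : ℝ) + 1 + β) j
    push_cast
    linear_combination -(gbinomR ((N : ℝ) + 1 + α) (N - j)) * this
  have s1 : ∑ j ∈ Finset.range (N + 1), C (c j * (α + 1 + j)) * M j
      = ∑ j ∈ Finset.range (N + 1 + 1), C (((N : ℝ) + 1 - j) *
      (gbinomR ((N : ℝ) + 1 + α) (N + 1 - j) * gbinomR ((N : ℝ) + 1 + β) j)) * M j := by
    rw [Finset.sum_range_succ _ (N + 1), Finset.sum_congr rfl (fun j hj => by rw [h1 j hj])]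
    simp
  have s2 : ∑ j ∈ Finset.range (N + 1), C (c j * (β + 1 + N - j)) * M (j + 1)
      = ∑ j ∈ Finset.range (N + 1 + 1), C ((j : ℝ) *
      (gbinomR ((N : ℝ) + 1 + α) (N + 1 - j) * gbinomR ((N : ℝ) + 1 + β) j)) * M j := by
    rw [Finset.sum_range_succ' _ (N + 1), Finset.sum_congr rfl (fun j hj => by rw [h2 j hj])]
    simp
  have := congrArg₂ (· + ·) s1 s2
  simp only [hM] at this
  rw [this, ← Finset.sum_add_distrib]
  refine Finset.sum_congr rfl fun j _ => ?_
  rw [← add_mul, ← C_add]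
  congr 2
  ring

lemma jacobi_step (N : ℕ) (α β : ℝ) (hαβ : α + β + 2 * ((N + 1 : ℕ) : ℝ) < -1) (hα : -1 < α)
    (q : ℝ[X]) (hq : q.natDegree ≤ N + 1) :
    2 * ((N : ℝ) + 1) * auxJ (q * jacobiR (N + 1) α β) α β
      = - auxJ (derivative q * jacobiR N (α + 1) (β + 1)) (α + 1) (β + 1) := by
  push_cast at hαβ
  set Q := jacobiR N (α + 1) (β + 1) with hQ
  have hQd : Q.natDegree ≤ N := jacobiR_natDegree _ _ _
  have hp := auxJ_parts (q * Q) (2 * N + 1)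
    ((natDegree_mul_le_of_le hq hQd).trans (by omega)) α β hα (by push_cast; linarith)
  have hexp : C (α + 1) * (X + 1) * (q * Q) + C (β + 1) * (X - 1) * (q * Q)
      + (X - 1) * (X + 1) * derivative (q * Q)
      = C (2 * ((N : ℝ) + 1)) * (q * jacobiR (N + 1) α β)
        + (X - 1) * (X + 1) * (derivative q * Q) := by
    have := jacobiR_rec N α β
    rw [← hQ] at this
    rw [derivative_mul]
    linear_combination q * this
  have hqd : (derivative q).natDegree ≤ N := (natDegree_derivative_le q).trans (by omega)
  have hA : ((X - 1) * (X + 1) : ℝ[X]).natDegree ≤ 2 :=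
    natDegree_mul_le_of_le (m := 1) (n := 1) (by compute_degree) (by compute_degree)
  rw [hexp, auxJ_add _ _ (2 * N + 2) ?_ ?_ α β hα (by push_cast; linarith), auxJ_C_mul,
    auxJ_shift] at hp
  · linarith
  · refine (natDegree_C_mul_le _ _).trans ?_
    exact (natDegree_mul_le_of_le hq (jacobiR_natDegree _ _ _)).trans (by omega)
  · exact (natDegree_mul_le_of_le hA (natDegree_mul_le_of_le hqd hQd)).trans (by omega)

lemma jacobi_orth (n : ℕ) : ∀ (α β : ℝ), α + β + 2 * (n : ℝ) < -1 → -1 < α →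
    (∀ q : ℝ[X], q.natDegree < n → auxJ (q * jacobiR n α β) α β = 0) ∧
    auxJ (X ^ n * jacobiR n α β) α β ≠ 0 := by
  induction n with
  | zero =>
    intro α β h1 h2
    refine ⟨fun q hq => absurd hq (by omega), ?_⟩
    have : X ^ 0 * jacobiR 0 α β = 1 := by simp [jacobiR, gbinomR]
    rw [this]
    refine (auxJ_pos 1 one_ne_zero 0 (by simp) α β h2 (by simpa using h1) ?_).ne'
    intro t _
    simp
  | succ N ih =>
    intro α β h1 h2
    have hN : (2 * ((N : ℝ) + 1)) ≠ 0 := by positivity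
    obtain ⟨ih1, ih2⟩ := ih (α + 1) (β + 1) (by push_cast at h1; linarith) (by linarith)
    constructor
    · intro q hq
      have hs := jacobi_step N α β h1 h2 q hq.le
      have : auxJ (derivative q * jacobiR N (α + 1) (β + 1)) (α + 1) (β + 1) = 0 := by
        rcases Nat.eq_zero_or_pos q.natDegree with h0 | h0
        · rw [derivative_of_natDegree_zero h0]
          simp [auxJ]
        · have := natDegree_derivative_lt (Nat.pos_iff_ne_zero.mp h0)
          exact ih1 _ (by omega)
      rw [this, neg_zero] at hs
      exact (mul_eq_zero.mp hs).resolve_left hN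
    · intro h0
      have hs := jacobi_step N α β h1 h2 (X ^ (N + 1)) (by simp)
      rw [h0, mul_zero, derivative_X_pow, mul_assoc] at hs
      rw [auxJ_C_mul] at hs
      simp only [Nat.add_sub_cancel] at hs
      have hN' : (((N + 1 : ℕ)) : ℝ) ≠ 0 := by positivity
      exact mul_ne_zero hN' ih2 (neg_eq_zero.mp hs.symm)

lemma aux_sign (P : ℝ[X]) (hP : P ≠ 0) :
    ∃ S : Finset ℝ, S ⊆ P.roots.toFinset ∧ (∀ x ∈ S, 1 < x) ∧
      ((∀ t : ℝ, 1 < t → 0 ≤ ((∏ a ∈ S, (X - C a)) * P).eval t) ∨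
       (∀ t : ℝ, 1 < t → 0 ≤ (-((∏ a ∈ S, (X - C a)) * P)).eval t)) := by
  classical
  obtain ⟨g, hg, -, hgr⟩ := exists_prod_multiset_X_sub_C_mul P
  have hg0 : g ≠ 0 := by
    rintro rfl
    exact hP (by rw [← hg, mul_zero])
  have hgt : ∀ t, g.eval t ≠ 0 := by
    intro t ht
    have : t ∈ g.roots := (mem_roots hg0).mpr ht
    rw [hgr] at this
    simp at this
  have hgs : (∀ t, 0 ≤ g.eval t) ∨ (∀ t, g.eval t ≤ 0) := by
    by_contra hcon
    push Not at hcon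
    obtain ⟨⟨s, hs⟩, ⟨u, hu⟩⟩ := hcon
    obtain ⟨r, hr⟩ := mem_range_of_exists_le_of_exists_ge g.continuous ⟨s, hs.le⟩ ⟨u, hu.le⟩
    exact hgt r hr
  set S := P.roots.toFinset.filter (fun a => 1 < a ∧ Odd (P.roots.count a)) with hS
  have hh : ∀ t : ℝ, 1 < t →
      0 ≤ (∏ a ∈ S, (t - a)) * ∏ a ∈ P.roots.toFinset, (t - a) ^ (P.roots.count a) := by
    intro t ht
    rw [hS, Finset.prod_filter, ← Finset.prod_mul_distrib]
    refine Finset.prod_nonneg fun a _ => ?_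
    split_ifs with h
    · rw [← pow_succ']
      exact (h.2.add_one).pow_nonneg _
    · rw [one_mul]
      by_cases h1 : 1 < a
      · have : ¬ Odd (P.roots.count a) := fun h2 => h ⟨h1, h2⟩
        exact (Nat.not_odd_iff_even.mp this).pow_nonneg _
      · exact pow_nonneg (by linarith) _
  have hev : ∀ t : ℝ, ((∏ a ∈ S, (X - C a)) * P).eval t =
      ((∏ a ∈ S, (t - a)) * ∏ a ∈ P.roots.toFinset, (t - a) ^ (P.roots.count a)) * g.eval t := by
    intro t
    conv_lhs => rw [← hg]
    rw [eval_mul, eval_mul, Finset.prod_multiset_map_count, eval_prod, eval_prod]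
    simp [mul_assoc]
  refine ⟨S, Finset.filter_subset _ _, fun x hx => (Finset.mem_filter.mp hx).2.1, ?_⟩
  rcases hgs with h | h
  · left
    intro t ht
    rw [hev]
    exact mul_nonneg (hh t ht) (h t)
  · right
    intro t ht
    rw [eval_neg, hev, ← mul_neg]
    exact mul_nonneg (hh t ht) (by linarith [h t])

/-- For `α + β + 2n < -1`, `α > -1` and `α, β, α+β ∉ ℤ`: the integrals
`∫_1^∞ t^k P_n^{(α,β)}(t) (t-1)^α (t+1)^β dt` converge for `k ≤ n`, vanish for
`k < n` and are nonzero for `k = n`; consequently `P_n^{(α,β)}` has exactly `n` simple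
zeros, all in `(1, ∞)`. -/
theorem jacobi_orthogonality_on_ray (n : ℕ) (α β : ℝ)
    (hαβ : α + β + 2 * n < -1) (hα : -1 < α)
    (hαZ : ¬∃ m : ℤ, α = m) (hβZ : ¬∃ m : ℤ, β = m) (hαβZ : ¬∃ m : ℤ, α + β = m) :
    (∀ k ≤ n, MeasureTheory.IntegrableOn
      (fun t => t ^ k * |(jacobiR n α β).eval t| * (t - 1) ^ α * (t + 1) ^ β)
      (Set.Ioi (1:ℝ)) MeasureTheory.volume) ∧
    (∀ k < n, (∫ t in Set.Ioi (1:ℝ),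
        t ^ k * (jacobiR n α β).eval t * (t - 1) ^ α * (t + 1) ^ β) = 0) ∧
    (∫ t in Set.Ioi (1:ℝ),
        t ^ n * (jacobiR n α β).eval t * (t - 1) ^ α * (t + 1) ^ β) ≠ 0 ∧
    ((jacobiR n α β).roots.toFinset.card = n ∧ (jacobiR n α β).roots.Nodup ∧
      ∀ x ∈ (jacobiR n α β).roots, x ∈ Set.Ioi (1:ℝ)) := by
  obtain ⟨ho, hn⟩ := jacobi_orth n α β hαβ hα
  have hdeg := jacobiR_natDegree n α β
  have hP : jacobiR n α β ≠ 0 := by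
    intro h
    apply hn
    rw [h]
    simp [auxJ]
  have hbig : ∃ S : Finset ℝ, S ⊆ (jacobiR n α β).roots.toFinset ∧ (∀ x ∈ S, 1 < x) ∧ n ≤ S.card := by
    obtain ⟨S, hS1, hS2, hS3⟩ := aux_sign _ hP
    refine ⟨S, hS1, hS2, ?_⟩
    by_contra hlt
    push Not at hlt
    have hqd : (∏ a ∈ S, (X - C a) : ℝ[X]).natDegree = S.card := by
      rw [natDegree_prod_of_monic _ _ (fun a _ => monic_X_sub_C a)]
      simp
    have h0 := ho (∏ a ∈ S, (X - C a)) (by rw [hqd]; exact hlt)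
    have hne : (∏ a ∈ S, (X - C a)) * jacobiR n α β ≠ 0 :=
      mul_ne_zero (monic_prod_of_monic _ _ (fun a _ => monic_X_sub_C a)).ne_zero hP
    have hd2 : ((∏ a ∈ S, (X - C a)) * jacobiR n α β).natDegree ≤ 2 * n :=
      (natDegree_mul_le_of_le hqd.le hdeg).trans (by omega)
    rcases hS3 with h | h
    · exact (auxJ_pos _ hne (2 * n) hd2 α β hα (by push_cast; linarith) h).ne' h0
    · refine (auxJ_pos _ (neg_ne_zero.mpr hne) (2 * n) (by rwa [natDegree_neg]) α β hα
        (by push_cast; linarith) h).ne' ?_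
      rw [neg_eq_neg_one_mul, ← C_1, ← C_neg, auxJ_C_mul, h0, mul_zero]
  refine ⟨?_, ?_, ?_, ?_⟩
  · intro k hk
    have hi := (aux_int (X ^ k * jacobiR n α β) (2 * n)
      ((natDegree_mul_le_of_le (natDegree_X_pow_le k) hdeg).trans (by omega)) α β hα
      (by push_cast; linarith)).norm
    refine IntegrableOn.congr_fun hi ?_ measurableSet_Ioi
    intro t ht
    have h : (1 : ℝ) < t := ht
    simp only [eval_mul, eval_pow, eval_X, Real.norm_eq_abs, abs_mul, abs_pow]
    rw [abs_of_pos (by linarith : 0 < t), abs_of_pos (Real.rpow_pos_of_pos (by linarith) α),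
      abs_of_pos (Real.rpow_pos_of_pos (by linarith) β)]
  · intro k hk
    have := ho (X ^ k) (by simpa using hk)
    simpa [auxJ] using this
  · simpa [auxJ] using hn
  · obtain ⟨S, hS1, hS2, hS3⟩ := hbig
    have c1 : S.card ≤ (jacobiR n α β).roots.toFinset.card := Finset.card_le_card hS1
    have c2 := Multiset.toFinset_card_le (jacobiR n α β).roots
    have c3 := (jacobiR n α β).card_roots'
    have hEq : S = (jacobiR n α β).roots.toFinset := Finset.eq_of_subset_of_card_le hS1 (by omega)
    refine ⟨by omega, ?_, ?_⟩
    · exact Multiset.toFinset_card_eq_card_iff_nodup.mp (by omega)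
    · intro x hx
      exact hS2 x (by rw [hEq]; exact Multiset.mem_toFinset.mpr hx)
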